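/- arXiv:1409.2913 — 2 statements merged into one kernel-verified Lean document; each statement's English description precedes it below -/
import Mathlib

section
/- Gaussian Urysohn inequality: if K ⊂ ℝⁿ is a convex body and B is a centered Euclidean ball with γ_n(K) = γ_n(B), then the Gaussian mean-width satisfies w(K) ≥ w(B). -/
open MeasureTheory Real
open scoped RealInnerProductSpace Pointwise

/-- The standard Gaussian measure on `ℝⁿ`. -/
noncomputable def gauss (n : ℕ) : Measure (EuclideanSpace ℝ (Fin n)) :=
  volume.withDensity (fun x => ENNReal.ofReal ((2 * π) ^ (-(n : ℝ) / 2) * Real.exp (-‖x‖ ^ 2 / 2)))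

/-- The Gaussian mean-width `w(K) = E[sup_{x ∈ K} ⟨Γ, x⟩]` of a set `K ⊆ ℝⁿ`. -/
noncomputable def meanWidth (n : ℕ) (K : Set (EuclideanSpace ℝ (Fin n))) : ℝ :=
  ∫ g, sSup ((fun x => ⟪g, x⟫) '' K) ∂(gauss n)

lemma bm_compact {A B C : Set ℝ} (hA : IsCompact A) (hB : IsCompact B) (hAn : A.Nonempty)
    (hBn : B.Nonempty) (h : ∀ x ∈ A, ∀ y ∈ B, x + y ∈ C) :
    volume A + volume B ≤ volume C := by
  obtain ⟨M, hM, hM'⟩ := hA.exists_isGreatest hAn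
  obtain ⟨m, hm, hm'⟩ := hB.exists_isLeast hBn
  have h1 : volume ((fun x => x + m) '' A) = volume A := by simp
  have h2 : volume ((fun x => M + x) '' B) = volume B := by simp
  have hd : AEDisjoint volume ((fun x => x + m) '' A) ((fun x => M + x) '' B) := by
    have : ((fun x => x + m) '' A) ∩ ((fun x => M + x) '' B) ⊆ {M + m} := by
      rintro _ ⟨⟨x, hx, rfl⟩, ⟨y, hy, hxy⟩⟩
      have := hM' hx
      have := hm' hy
      simp only [Set.mem_singleton_iff] at *
      linarith
    exact measure_mono_null this (by simp)
  have hmB : MeasurableSet ((fun x => M + x) '' B) :=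
    (hB.image (by fun_prop)).measurableSet
  rw [← h1, ← h2, ← measure_union₀ hmB.nullMeasurableSet hd]
  apply measure_mono
  rintro _ (⟨x, hx, rfl⟩ | ⟨x, hx, rfl⟩)
  · exact h _ hx _ hm
  · exact h _ hM _ hx

lemma bm_meas {A B C : Set ℝ} (hA : MeasurableSet A) (hB : MeasurableSet B) (hAn : A.Nonempty)
    (hBn : B.Nonempty) (h : ∀ x ∈ A, ∀ y ∈ B, x + y ∈ C) :
    volume A + volume B ≤ volume C := by
  rw [hA.measure_eq_iSup_isCompact, hB.measure_eq_iSup_isCompact]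
  simp_rw [iSup_and']
  obtain ⟨x0, hx0⟩ := hAn
  obtain ⟨y0, hy0⟩ := hBn
  refine ENNReal.biSup_add_biSup_le' ⟨∅, by simp⟩ ⟨∅, by simp⟩ ?_
  rintro K ⟨hKA, hK⟩ L ⟨hLB, hL⟩
  calc volume K + volume L ≤ volume (insert x0 K) + volume (insert y0 L) := by
        gcongr <;> simp
    _ ≤ volume C := by
        refine bm_compact (hK.insert _) (hL.insert _) (by simp) (by simp) ?_
        intro x hx y hy
        exact h x (Set.insert_subset hx0 hKA hx) y (Set.insert_subset hy0 hLB hy)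

lemma bm_weighted {a b : ℝ} (ha : 0 < a) (hb : 0 < b)
    {A B C : Set ℝ} (hA : MeasurableSet A) (hB : MeasurableSet B) (hAn : A.Nonempty)
    (hBn : B.Nonempty) (h : ∀ x ∈ A, ∀ y ∈ B, a * x + b * y ∈ C) :
    ENNReal.ofReal a * volume A + ENNReal.ofReal b * volume B ≤ volume C := by
  have h1 : volume (a • A) = ENNReal.ofReal a * volume A := by
    rw [Measure.addHaar_smul]; simp [abs_of_pos ha]
  have h2 : volume (b • B) = ENNReal.ofReal b * volume B := by
    rw [Measure.addHaar_smul]; simp [abs_of_pos hb]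
  rw [← h1, ← h2]
  refine bm_meas (hA.const_smul₀ a) (hB.const_smul₀ b) (hAn.smul_set) (hBn.smul_set) ?_
  rintro _ ⟨x, hx, rfl⟩ _ ⟨y, hy, rfl⟩
  exact h x hx y hy

lemma amgm {a b : ℝ} (ha : 0 < a) (hb : 0 < b) (hab : a + b = 1) (x y : ENNReal) :
    x ^ a * y ^ b ≤ ENNReal.ofReal a * x + ENNReal.ofReal b * y := by
  have hpq : (1 / a).HolderConjugate (1 / b) := by
    rw [Real.holderConjugate_iff]
    refine ⟨?_, by simpa using hab⟩
    rw [lt_div_iff₀ ha]; linarith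
  have := ENNReal.young_inequality (x ^ a) (y ^ b) hpq
  rw [← ENNReal.rpow_mul, ← ENNReal.rpow_mul, mul_one_div_cancel ha.ne', mul_one_div_cancel hb.ne',
    ENNReal.rpow_one, ENNReal.rpow_one, one_div, one_div, ENNReal.ofReal_inv_of_pos ha,
    ENNReal.ofReal_inv_of_pos hb, div_eq_mul_inv, div_eq_mul_inv, inv_inv, inv_inv, mul_comm x,
    mul_comm y] at this
  exact this

lemma pl_normalized {a b : ℝ} (ha : 0 < a) (hb : 0 < b) {f g h : ℝ → ℝ}
    (hf : Measurable f) (hg : Measurable g) (hh : Measurable h)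
    (f0 : ∀ x, 0 ≤ f x) (g0 : ∀ x, 0 ≤ g x) (h0 : ∀ x, 0 ≤ h x)
    (f1 : ∀ x, f x ≤ 1) (g1 : ∀ x, g x ≤ 1)
    (fs : ∀ t < 1, ∃ x, t < f x) (gs : ∀ t < 1, ∃ x, t < g x)
    (H : ∀ x y t, 0 < t → t < f x → t < g y → t < h (a * x + b * y)) :
    ENNReal.ofReal a * (∫⁻ x, ENNReal.ofReal (f x)) + ENNReal.ofReal b * (∫⁻ x, ENNReal.ofReal (g x))
      ≤ ∫⁻ x, ENNReal.ofReal (h x) := by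
  rw [lintegral_eq_lintegral_meas_lt _ (.of_forall f0) hf.aemeasurable,
    lintegral_eq_lintegral_meas_lt _ (.of_forall g0) hg.aemeasurable,
    lintegral_eq_lintegral_meas_lt _ (.of_forall h0) hh.aemeasurable,
    ← lintegral_const_mul' _ _ ENNReal.ofReal_ne_top,
    ← lintegral_const_mul' _ _ ENNReal.ofReal_ne_top, ← lintegral_add_left']
  · refine setLIntegral_mono' measurableSet_Ioi ?_
    intro t ht
    by_cases ht1 : t < 1
    · refine bm_weighted ha hb (measurableSet_lt measurable_const hf)
        (measurableSet_lt measurable_const hg) (fs t ht1) (gs t ht1) ?_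
      intro x hx y hy
      exact H x y t ht hx hy
    · have e1 : {x | t < f x} = ∅ := by
        ext x; simp; linarith [f1 x]
      have e2 : {x | t < g x} = ∅ := by
        ext x; simp; linarith [g1 x]
      simp [e1, e2]
  · refine AEMeasurable.const_mul ?_ _
    refine Measurable.aemeasurable ?_
    refine Antitone.measurable ?_
    intro s t hst
    exact measure_mono fun x (hx : t < f x) => lt_of_le_of_lt hst hx

lemma pl_bounded {a b : ℝ} (ha : 0 < a) (hb : 0 < b) (hab : a + b = 1) {f g h : ℝ → ENNReal}
    (hf : Measurable f) (hg : Measurable g) (hh : Measurable h) {m : ENNReal} (hm : m ≠ ⊤)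
    (fm : ∀ x, f x ≤ m) (gm : ∀ x, g x ≤ m)
    (H : ∀ x y, f x ^ a * g y ^ b ≤ h (a * x + b * y)) :
    (∫⁻ x, f x) ^ a * (∫⁻ x, g x) ^ b ≤ ∫⁻ x, h x := by
  set F := ⨆ x, f x with hF
  set G := ⨆ x, g x with hG
  have hFt : F ≠ ⊤ := ne_top_of_le_ne_top hm (iSup_le fm)
  have hGt : G ≠ ⊤ := ne_top_of_le_ne_top hm (iSup_le gm)
  rcases eq_or_ne F 0 with hF0 | hF0
  · have : ∀ x, f x = 0 := by simpa [hF] using hF0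
    simp [this, ha]
  rcases eq_or_ne G 0 with hG0 | hG0
  · have : ∀ x, g x = 0 := by simpa [hG] using hG0
    simp [this, hb]
  set c := F ^ a * G ^ b with hc
  have hFa0 : F ^ a ≠ 0 := by simp [hF0, hFt]
  have hGb0 : G ^ b ≠ 0 := by simp [hG0, hGt]
  have hFat : F ^ a ≠ ⊤ := ENNReal.rpow_ne_top_of_nonneg ha.le hFt
  have hGbt : G ^ b ≠ ⊤ := ENNReal.rpow_ne_top_of_nonneg hb.le hGt
  have hc0 : c ≠ 0 := mul_ne_zero hFa0 hGb0
  have hct : c ≠ ⊤ := ENNReal.mul_ne_top hFat hGbt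
  have f1 : ∀ x, f x / F ≤ 1 := fun x => ENNReal.div_le_of_le_mul (by simpa using le_iSup f x)
  have g1 : ∀ x, g x / G ≤ 1 := fun x => ENNReal.div_le_of_le_mul (by simpa using le_iSup g x)
  have ft : ∀ x, f x / F ≠ ⊤ := fun x => ne_top_of_le_ne_top (by simp) (f1 x)
  have gt : ∀ x, g x / G ≠ ⊤ := fun x => ne_top_of_le_ne_top (by simp) (g1 x)
  have ht : ∀ x, min 1 (h x / c) ≠ ⊤ := fun x => ne_top_of_le_ne_top (by simp) (min_le_left _ _)
  have sup_aux : ∀ (f : ℝ → ENNReal) (F : ENNReal), F = ⨆ x, f x → F ≠ 0 → F ≠ ⊤ →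
      (∀ x, f x / F ≠ ⊤) → ∀ t : ℝ, t < 1 → ∃ x, t < (f x / F).toReal := by
    intro f F hF h0 ht hft t ht1
    have : ENNReal.ofReal t * F < F := by
      calc ENNReal.ofReal t * F < 1 * F := by
            rw [ENNReal.mul_lt_mul_iff_left h0 ht]
            simpa using ht1
        _ = F := one_mul F
    conv_rhs at this => rw [hF]
    obtain ⟨x, hx⟩ := lt_iSup_iff.1 this
    refine ⟨x, ?_⟩
    have h2 := (ENNReal.lt_div_iff_mul_lt (Or.inl h0) (Or.inl ht)).2 hx
    by_contra hle
    rw [← ENNReal.ofReal_toReal (hft x)] at h2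
    exact absurd (ENNReal.ofReal_le_ofReal (not_lt.1 hle)) (not_le.2 h2)
  have key := pl_normalized (f := fun x => (f x / F).toReal) (g := fun x => (g x / G).toReal)
    (h := fun x => (min 1 (h x / c)).toReal) ha hb
    (hf.div_const F).ennreal_toReal (hg.div_const G).ennreal_toReal
    (measurable_const.min (hh.div_const c)).ennreal_toReal
    (fun _ => ENNReal.toReal_nonneg) (fun _ => ENNReal.toReal_nonneg)
    (fun _ => ENNReal.toReal_nonneg)
    (fun x => ENNReal.toReal_le_of_le_ofReal zero_le_one (by simpa using f1 x))
    (fun x => ENNReal.toReal_le_of_le_ofReal zero_le_one (by simpa using g1 x))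
    (sup_aux f F hF hF0 hFt ft) (sup_aux g G hG hG0 hGt gt) (by
      intro x y t t0 htf htg
      have e : min (f x / F) (g y / G) ≤ min 1 (h (a * x + b * y) / c) := by
        refine le_min ((min_le_left _ _).trans (f1 x)) ?_
        set s := min (f x / F) (g y / G)
        have s0 : s ^ a * s ^ b = s := by
          rw [← ENNReal.rpow_add_of_nonneg _ _ ha.le hb.le, hab, ENNReal.rpow_one]
        rw [← s0]
        calc s ^ a * s ^ b ≤ (f x / F) ^ a * (g y / G) ^ b := by
              gcongr
              · exact min_le_left _ _
              · exact min_le_right _ _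
          _ = (f x ^ a * g y ^ b) / c := by
              rw [ENNReal.div_rpow_of_nonneg _ _ ha.le, ENNReal.div_rpow_of_nonneg _ _ hb.le, hc,
                div_eq_mul_inv, div_eq_mul_inv, div_eq_mul_inv, ENNReal.mul_inv (by simp [hFa0]) (by simp [hGb0])]
              ring
          _ ≤ _ := by gcongr; exact H x y
      refine lt_of_lt_of_le ?_ (ENNReal.toReal_mono (ht _) e)
      rw [ENNReal.toReal_min (ft x) (gt y)]
      exact lt_min htf htg)
  simp only [ENNReal.ofReal_toReal (ft _), ENNReal.ofReal_toReal (gt _),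
    ENNReal.ofReal_toReal (ht _)] at key
  have key2 : (∫⁻ x, f x / F) ^ a * (∫⁻ x, g x / G) ^ b ≤ ∫⁻ x, h x / c :=
    ((amgm ha hb hab _ _).trans key).trans (lintegral_mono fun x => min_le_right _ _)
  simp only [div_eq_mul_inv] at key2
  rw [lintegral_mul_const _ hf, lintegral_mul_const _ hg, lintegral_mul_const _ hh,
    ENNReal.mul_rpow_of_nonneg _ _ ha.le, ENNReal.mul_rpow_of_nonneg _ _ hb.le,
    ENNReal.inv_rpow, ENNReal.inv_rpow] at key2
  have key3 : (∫⁻ x, f x) ^ a * (∫⁻ x, g x) ^ b * c⁻¹ ≤ (∫⁻ x, h x) * c⁻¹ := by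
    refine le_trans (le_of_eq ?_) key2
    rw [hc, ENNReal.mul_inv (by simp [hFa0]) (by simp [hGb0])]
    ring
  exact (ENNReal.mul_le_mul_iff_left (ENNReal.inv_ne_zero.2 hct) (ENNReal.inv_ne_top.2 hc0)).1 key3

lemma pl_one {a b : ℝ} (ha : 0 < a) (hb : 0 < b) (hab : a + b = 1) {f g h : ℝ → ENNReal}
    (hf : Measurable f) (hg : Measurable g) (hh : Measurable h)
    (H : ∀ x y, f x ^ a * g y ^ b ≤ h (a * x + b * y)) :
    (∫⁻ x, f x) ^ a * (∫⁻ x, g x) ^ b ≤ ∫⁻ x, h x := by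
  rcases eq_or_ne (∫⁻ x, f x) 0 with hF0 | hF0
  · simp [hF0, ha]
  rcases eq_or_ne (∫⁻ x, g x) 0 with hG0 | hG0
  · simp [hG0, hb]
  have lim : ∀ f : ℝ → ENNReal, Measurable f → Filter.Tendsto
      (fun m : ℕ => ∫⁻ x, min (f x) m) Filter.atTop (nhds (∫⁻ x, f x)) := by
    intro f hf
    refine lintegral_tendsto_of_tendsto_of_monotone
      (fun n => (hf.min measurable_const).aemeasurable) ?_ ?_
    · refine .of_forall fun x n m hnm => ?_
      dsimp
      gcongr
    · refine .of_forall fun x => ?_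
      have := (tendsto_const_nhds (x := f x)).min ENNReal.tendsto_nat_nhds_top
      simpa using this
  refine le_of_tendsto' (ENNReal.Tendsto.mul
    ((ENNReal.continuous_rpow_const (y := a)).continuousAt.tendsto.comp (lim f hf)) ?_
    ((ENNReal.continuous_rpow_const (y := b)).continuousAt.tendsto.comp (lim g hg)) ?_)
    (fun m => pl_bounded ha hb hab (hf.min measurable_const)
      (hg.min measurable_const) hh (m := m) (by simp) (fun x => min_le_right _ _)
      (fun x => min_le_right _ _) ?_)
  · left; simp [hF0, ha, ha.not_gt]
  · left; simp [hG0, hb, hb.not_gt]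
  · intro x y
    refine le_trans ?_ (H x y)
    gcongr <;> exact min_le_left _ _

lemma pl_pi {a b : ℝ} (ha : 0 < a) (hb : 0 < b) (hab : a + b = 1) (n : ℕ) :
    ∀ {f g h : (Fin n → ℝ) → ENNReal}, Measurable f → Measurable g → Measurable h →
    (∀ x y, f x ^ a * g y ^ b ≤ h (a • x + b • y)) →
    (∫⁻ x, f x) ^ a * (∫⁻ x, g x) ^ b ≤ ∫⁻ x, h x := by
  induction n with
  | zero =>
    intro f g h hf hg hh H
    have e : (volume : Measure (Fin 0 → ℝ)) = Measure.dirac 0 := by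
      rw [volume_pi, Measure.pi_of_empty _ 0]
    rw [e, lintegral_dirac, lintegral_dirac, lintegral_dirac]
    simpa using H 0 0
  | succ n ih =>
    intro f g h hf hg hh H
    let e := MeasurableEquiv.piFinSuccAbove (fun _ : Fin (n+1) => ℝ) 0
    have he := (volume_preserving_piFinSuccAbove (fun _ : Fin (n+1) => ℝ) 0).symm
    have conv : ∀ f : (Fin (n+1) → ℝ) → ENNReal, Measurable f →
        ∫⁻ x, f x = ∫⁻ t, ∫⁻ x, f (e.symm (t, x)) := by
      intro f hf
      rw [← he.lintegral_comp hf, Measure.volume_eq_prod, lintegral_prod]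
      exact (hf.comp e.symm.measurable).aemeasurable
    have meas : ∀ f : (Fin (n+1) → ℝ) → ENNReal, Measurable f →
        Measurable (fun t => ∫⁻ x, f (e.symm (t, x))) := fun f hf =>
      (hf.comp e.symm.measurable).lintegral_prod_right'
    rw [conv f hf, conv g hg, conv h hh]
    refine pl_one ha hb hab (meas f hf) (meas g hg) (meas h hh) ?_
    intro s t
    have mp : ∀ (f : (Fin (n+1) → ℝ) → ENNReal) (s : ℝ), Measurable f →
        Measurable (fun x => f (e.symm (s, x))) := fun f s hf =>
      hf.comp (e.symm.measurable.comp measurable_prodMk_left)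
    refine ih (mp f s hf) (mp g t hg) (mp h _ hh) ?_
    intro x y
    refine (H _ _).trans (le_of_eq ?_)
    congr 1
    ext i
    refine Fin.cases ?_ (fun i => ?_) i <;> simp [e, MeasurableEquiv.piFinSuccAbove]

lemma pl_euclid {a b : ℝ} (ha : 0 < a) (hb : 0 < b) (hab : a + b = 1) (n : ℕ)
    {f g h : EuclideanSpace ℝ (Fin n) → ENNReal} (hf : Measurable f) (hg : Measurable g)
    (hh : Measurable h) (H : ∀ x y, f x ^ a * g y ^ b ≤ h (a • x + b • y)) :
    (∫⁻ x, f x) ^ a * (∫⁻ x, g x) ^ b ≤ ∫⁻ x, h x := by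
  have hp := PiLp.volume_preserving_toLp (Fin n)
  rw [← hp.lintegral_comp hf, ← hp.lintegral_comp hg, ← hp.lintegral_comp hh]
  refine pl_pi ha hb hab n (hf.comp hp.measurable) (hg.comp hp.measurable)
    (hh.comp hp.measurable) ?_
  intro x y
  simpa using H (WithLp.toLp 2 x) (WithLp.toLp 2 y)

/-- the density of `gauss`. -/
noncomputable def gdens (n : ℕ) (x : EuclideanSpace ℝ (Fin n)) : ℝ :=
  (2 * π) ^ (-(n : ℝ) / 2) * Real.exp (-‖x‖ ^ 2 / 2)

lemma gauss_eq (n : ℕ) : gauss n = volume.withDensity (fun x => ENNReal.ofReal (gdens n x)) := rfl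

lemma gdens_pos (n : ℕ) (x : EuclideanSpace ℝ (Fin n)) : 0 < gdens n x := by
  unfold gdens; positivity

lemma gdens_cont (n : ℕ) : Continuous (gdens n) := by
  unfold gdens; fun_prop

lemma gdens_meas (n : ℕ) : Measurable (fun x => ENNReal.ofReal (gdens n x)) :=
  (gdens_cont n).measurable.ennreal_ofReal

lemma gdens_logconcave {a b : ℝ} (ha : 0 < a) (hb : 0 < b) (hab : a + b = 1) (n : ℕ)
    (x y : EuclideanSpace ℝ (Fin n)) :
    gdens n x ^ a * gdens n y ^ b ≤ gdens n (a • x + b • y) := by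
  have hk : 0 < (2 * π) ^ (-(n : ℝ) / 2) := by positivity
  have e : ∀ x, gdens n x = Real.exp (Real.log ((2 * π) ^ (-(n : ℝ) / 2)) - ‖x‖ ^ 2 / 2) := by
    intro x
    rw [Real.exp_sub, Real.exp_log hk, gdens, neg_div 2 (‖x‖ ^ 2), Real.exp_neg]; rfl
  rw [e, e, e, ← Real.exp_mul, ← Real.exp_mul, ← Real.exp_add, Real.exp_le_exp]
  set L := Real.log ((2 * π) ^ (-(n : ℝ) / 2))
  have h1 : ‖a • x + b • y‖ ≤ a * ‖x‖ + b * ‖y‖ := by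
    refine (norm_add_le _ _).trans ?_
    rw [norm_smul, norm_smul, Real.norm_of_nonneg ha.le, Real.norm_of_nonneg hb.le]
  have h2 : ‖a • x + b • y‖ ^ 2 ≤ (a * ‖x‖ + b * ‖y‖) ^ 2 := by gcongr
  have hb' : b = 1 - a := by linarith
  have h3 : (a * ‖x‖ + b * ‖y‖) ^ 2 ≤ a * ‖x‖ ^ 2 + b * ‖y‖ ^ 2 := by
    have : 0 ≤ a * b * (‖x‖ - ‖y‖) ^ 2 := by positivity
    subst hb'
    nlinarith
  have : L * a + L * b = L := by rw [← mul_add, hab, mul_one]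
  nlinarith

lemma gauss_logconcave {a b : ℝ} (ha : 0 < a) (hb : 0 < b) (hab : a + b = 1) (n : ℕ)
    {A B C : Set (EuclideanSpace ℝ (Fin n))} (hA : MeasurableSet A) (hB : MeasurableSet B)
    (hC : MeasurableSet C) (H : ∀ x ∈ A, ∀ y ∈ B, a • x + b • y ∈ C) :
    gauss n A ^ a * gauss n B ^ b ≤ gauss n C := by
  rw [gauss_eq, withDensity_apply _ hA, withDensity_apply _ hB, withDensity_apply _ hC,
    ← lintegral_indicator hA, ← lintegral_indicator hB, ← lintegral_indicator hC]
  refine pl_euclid ha hb hab n ((gdens_meas n).indicator hA) ((gdens_meas n).indicator hB)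
    ((gdens_meas n).indicator hC) ?_
  intro x y
  by_cases hx : x ∈ A
  · by_cases hy : y ∈ B
    · rw [Set.indicator_of_mem hx, Set.indicator_of_mem hy, Set.indicator_of_mem (H x hx y hy),
        ENNReal.ofReal_rpow_of_pos (gdens_pos n x), ENNReal.ofReal_rpow_of_pos (gdens_pos n y),
        ← ENNReal.ofReal_mul (by have := gdens_pos n x; positivity)]
      exact ENNReal.ofReal_le_ofReal (gdens_logconcave ha hb hab n x y)
    · simp [hy, hb]
  · simp [hx, ha]

lemma gdens_integrable (n : ℕ) : Integrable (gdens n) := by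
  unfold gdens
  refine Integrable.const_mul ?_ _
  have := (GaussianFourier.integrable_cexp_neg_mul_sq_norm_add
    (V := EuclideanSpace ℝ (Fin n)) (b := 1/2) (by norm_num) 0 0).norm
  refine this.congr (.of_forall fun x => ?_)
  simp only [Complex.norm_exp]
  congr 1
  rw [zero_mul, add_zero, ← Complex.ofReal_pow, show (-(1/2 : ℂ)) = ((-(1/2) : ℝ) : ℂ) by simp,
    ← Complex.ofReal_mul, Complex.ofReal_re]
  ring

lemma norm_mul_gdens_integrable (n : ℕ) :
    Integrable (fun x : EuclideanSpace ℝ (Fin n) => ‖x‖ * gdens n x) := by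
  have h := (GaussianFourier.integrable_cexp_neg_mul_sq_norm_add
    (V := EuclideanSpace ℝ (Fin n)) (b := 1/4) (by norm_num) 0 0).norm.const_mul
      ((2 * π) ^ (-(n : ℝ) / 2))
  refine h.mono' (by have := gdens_cont n; fun_prop) (.of_forall fun x => ?_)
  rw [Real.norm_of_nonneg (by have := gdens_pos n x; positivity), Complex.norm_exp,
    zero_mul, add_zero, ← Complex.ofReal_pow, show (-(1/4 : ℂ)) = ((-(1/4) : ℝ) : ℂ) by simp,
    ← Complex.ofReal_mul, Complex.ofReal_re, gdens, mul_left_comm]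
  gcongr
  have h1 : ‖x‖ ≤ Real.exp (‖x‖ ^ 2 / 4) := by
    have := Real.add_one_le_exp (‖x‖ ^ 2 / 4)
    nlinarith [sq_nonneg (‖x‖ / 2 - 1)]
  calc ‖x‖ * Real.exp (-‖x‖ ^ 2 / 2) ≤ Real.exp (‖x‖ ^ 2 / 4) * Real.exp (-‖x‖ ^ 2 / 2) := by gcongr
    _ = _ := by rw [← Real.exp_add]; congr 1; ring

instance gauss_finite (n : ℕ) : IsFiniteMeasure (gauss n) := by
  rw [gauss_eq]
  exact isFiniteMeasure_withDensity_ofReal (gdens_integrable n).2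

lemma norm_integrable_gauss (n : ℕ) :
    Integrable (fun x : EuclideanSpace ℝ (Fin n) => ‖x‖) (gauss n) := by
  rw [gauss_eq, integrable_withDensity_iff (gdens_meas n) (by simp)]
  refine (norm_mul_gdens_integrable n).congr (.of_forall fun x => ?_)
  simp [(gdens_pos n x).le]

lemma gauss_map (n : ℕ) (e : EuclideanSpace ℝ (Fin n) ≃ₗᵢ[ℝ] EuclideanSpace ℝ (Fin n)) :
    MeasurePreserving e (gauss n) (gauss n) := by
  refine ⟨e.continuous.measurable, ?_⟩
  ext s hs
  have hs' : MeasurableSet (e ⁻¹' s) := e.continuous.measurable hs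
  rw [Measure.map_apply e.continuous.measurable hs, gauss_eq, withDensity_apply _ hs,
    withDensity_apply _ hs', ← e.measurePreserving.setLIntegral_comp_preimage hs (gdens_meas n)]
  simp [gdens]

lemma gauss_closedBall_lt {n : ℕ} (hn : n ≠ 0) {c r : ℝ} (hc : 0 ≤ c) (hcr : c < r) :
    gauss n (Metric.closedBall 0 c) < gauss n (Metric.closedBall 0 r) := by
  have : Nonempty (Fin n) := ⟨⟨0, Nat.pos_of_ne_zero hn⟩⟩
  have : Nontrivial (EuclideanSpace ℝ (Fin n)) := inferInstance
  set U : Set (EuclideanSpace ℝ (Fin n)) := Metric.ball 0 r \ Metric.closedBall 0 c with hU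
  have hUo : IsOpen U := Metric.isOpen_ball.sdiff Metric.isClosed_closedBall
  have hUn : U.Nonempty := by
    obtain ⟨x, hx⟩ := NormedSpace.sphere_nonempty (x := (0 : EuclideanSpace ℝ (Fin n)))
      (r := (c + r) / 2) |>.2 (by linarith)
    refine ⟨x, ?_⟩
    simp only [mem_sphere_iff_norm, sub_zero] at hx
    simp only [hU, Set.mem_sdiff, Metric.mem_ball, dist_zero_right, Metric.mem_closedBall, hx]
    constructor <;> linarith
  have hpos : gauss n U ≠ 0 := by
    rw [gauss_eq, Ne, withDensity_apply_eq_zero (gdens_meas n)]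
    have : {x | ENNReal.ofReal (gdens n x) ≠ 0} ∩ U = U := by
      ext x; simp [gdens_pos n x]
    rw [this]
    exact (hUo.measure_pos volume hUn).ne'
  calc gauss n (Metric.closedBall 0 c)
      < gauss n (Metric.closedBall 0 c) + gauss n U :=
        ENNReal.lt_add_right (measure_ne_top _ _) hpos
    _ = gauss n (Metric.closedBall 0 c ∪ U) := by
        rw [measure_union Set.disjoint_sdiff_right hUo.measurableSet]
    _ ≤ _ := by
        apply measure_mono
        apply Set.union_subset (Metric.closedBall_subset_closedBall hcr.le)
        exact Set.sdiff_subset.trans Metric.ball_subset_closedBall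

/-- support function -/
noncomputable def supp {n : ℕ} (K : Set (EuclideanSpace ℝ (Fin n)))
    (g : EuclideanSpace ℝ (Fin n)) : ℝ := sSup ((fun x => ⟪g, x⟫) '' K)

lemma meanWidth_eq (n : ℕ) (K : Set (EuclideanSpace ℝ (Fin n))) :
    meanWidth n K = ∫ g, supp K g ∂(gauss n) := rfl

lemma supp_cont {n : ℕ} {K : Set (EuclideanSpace ℝ (Fin n))} (hK : IsCompact K) :
    Continuous (supp K) :=
  hK.continuous_sSup (f := fun g x => ⟪g, x⟫) (by
    show Continuous fun p : EuclideanSpace ℝ (Fin n) × EuclideanSpace ℝ (Fin n) => ⟪p.1, p.2⟫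
    fun_prop)

lemma supp_bdd {n : ℕ} {K : Set (EuclideanSpace ℝ (Fin n))} (hK : IsCompact K)
    (g : EuclideanSpace ℝ (Fin n)) : BddAbove ((fun x => ⟪g, x⟫) '' K) :=
  (hK.image (by fun_prop)).bddAbove

lemma le_supp {n : ℕ} {K : Set (EuclideanSpace ℝ (Fin n))} (hK : IsCompact K)
    (g : EuclideanSpace ℝ (Fin n)) {x} (hx : x ∈ K) : ⟪g, x⟫ ≤ supp K g :=
  le_csSup (supp_bdd hK g) ⟨x, hx, rfl⟩

lemma supp_smul {n : ℕ} (K : Set (EuclideanSpace ℝ (Fin n)))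
    {c : ℝ} (hc : 0 ≤ c) (g : EuclideanSpace ℝ (Fin n)) : supp K (c • g) = c * supp K g := by
  have := Real.sSup_smul_of_nonneg hc ((fun x => ⟪g, x⟫) '' K)
  rw [supp, supp, ← smul_eq_mul, ← this, ← Set.image_smul, Set.image_image]
  simp [real_inner_smul_left]

lemma supp_abs_le {n : ℕ} {K : Set (EuclideanSpace ℝ (Fin n))} (hK : IsCompact K)
    (hn : K.Nonempty) : ∃ R : ℝ, 0 ≤ R ∧ ∀ g, |supp K g| ≤ R * ‖g‖ := by
  obtain ⟨R, hR0, hR⟩ := hK.isBounded.exists_pos_norm_le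
  refine ⟨R, hR0.le, fun g => ?_⟩
  have key : ∀ x ∈ K, |⟪g, x⟫| ≤ R * ‖g‖ := fun x hx => by
    refine (abs_real_inner_le_norm g x).trans ?_
    rw [mul_comm]; gcongr; exact hR x hx
  rw [abs_le]
  constructor
  · obtain ⟨x, hx⟩ := hn
    exact (abs_le.1 (key x hx)).1.trans (le_supp hK g hx)
  · apply csSup_le (hn.image _)
    rintro _ ⟨x, hx, rfl⟩
    exact (abs_le.1 (key x hx)).2

lemma supp_ball {n : ℕ} {r : ℝ} (hr : 0 ≤ r) (g : EuclideanSpace ℝ (Fin n)) :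
    supp (Metric.closedBall 0 r) g = r * ‖g‖ := by
  apply IsLUB.csSup_eq _ ((Metric.nonempty_closedBall.2 hr).image _)
  refine IsGreatest.isLUB ⟨⟨(r * ‖g‖⁻¹) • g, ?_, ?_⟩, ?_⟩
  · rw [mem_closedBall_zero_iff, norm_smul, norm_mul, norm_inv, norm_norm, Real.norm_of_nonneg hr,
      mul_assoc]
    have : ‖g‖⁻¹ * ‖g‖ ≤ 1 := inv_mul_le_one
    nlinarith
  · simp only [real_inner_smul_right, real_inner_self_eq_norm_sq]
    rcases eq_or_ne g 0 with rfl | h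
    · simp
    · have : ‖g‖ ≠ 0 := by simpa using h
      field_simp
  · rintro _ ⟨x, hx, rfl⟩
    rw [mem_closedBall_zero_iff] at hx
    refine (real_inner_le_norm g x).trans ?_
    rw [mul_comm]; gcongr

/-- Wulff shape -/
def wulff {n : ℕ} (f : C(Metric.sphere (0 : EuclideanSpace ℝ (Fin n)) 1, ℝ)) :
    Set (EuclideanSpace ℝ (Fin n)) := {x | ∀ u : Metric.sphere (0 : EuclideanSpace ℝ (Fin n)) 1, ⟪(u : EuclideanSpace ℝ (Fin n)), x⟫ ≤ f u}

lemma wulff_closed {n : ℕ} (f : C(Metric.sphere (0 : EuclideanSpace ℝ (Fin n)) 1, ℝ)) :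
    IsClosed (wulff f) := by
  have : wulff f = ⋂ u : Metric.sphere (0 : EuclideanSpace ℝ (Fin n)) 1,
      {x | ⟪(u : EuclideanSpace ℝ (Fin n)), x⟫ ≤ f u} := by
    ext; simp [wulff]
  rw [this]
  exact isClosed_iInter fun u => isClosed_le (by fun_prop) continuous_const

lemma wulff_convex (n : ℕ) (m : ENNReal) :
    Convex ℝ {f : C(Metric.sphere (0 : EuclideanSpace ℝ (Fin n)) 1, ℝ) | m ≤ gauss n (wulff f)} := by
  rw [convex_iff_forall_pos]
  intro f hf g hg a b ha hb hab
  calc m = m ^ a * m ^ b := by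
        rw [← ENNReal.rpow_add_of_nonneg _ _ ha.le hb.le, hab, ENNReal.rpow_one]
    _ ≤ gauss n (wulff f) ^ a * gauss n (wulff g) ^ b := by
        gcongr
        · exact hf
        · exact hg
    _ ≤ _ := by
        refine gauss_logconcave ha hb hab n (wulff_closed _).measurableSet
          (wulff_closed _).measurableSet (wulff_closed _).measurableSet ?_
        intro x hx y hy u
        simp only [inner_add_right, real_inner_smul_right, ContinuousMap.add_apply,
          ContinuousMap.smul_apply, smul_eq_mul]
        have := hx u
        have := hy u
        gcongr

lemma wulff_isClosed (n : ℕ) (m : ENNReal) :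
    IsClosed {f : C(Metric.sphere (0 : EuclideanSpace ℝ (Fin n)) 1, ℝ) | m ≤ gauss n (wulff f)} := by
  rw [← closure_subset_iff_isClosed]
  intro f hf
  have e : wulff f = ⋂ k : ℕ, wulff (f + ContinuousMap.const _ (1 / ((k : ℝ) + 1))) := by
    ext x
    simp only [Set.mem_iInter]
    constructor
    · intro hx k u
      have : (0 : ℝ) < 1 / ((k : ℝ) + 1) := by positivity
      have := hx u
      simp only [ContinuousMap.add_apply, ContinuousMap.const_apply]
      linarith
    · intro hx u
      have lim : Filter.Tendsto (fun k : ℕ => f u + 1 / ((k : ℝ) + 1)) Filter.atTop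
          (nhds (f u + 0)) := tendsto_const_nhds.add tendsto_one_div_add_atTop_nhds_zero_nat
      rw [add_zero] at lim
      exact ge_of_tendsto' lim fun k => hx k u
  show m ≤ gauss n (wulff f)
  have hanti : Antitone fun k : ℕ => wulff (f + ContinuousMap.const _ (1 / ((k : ℝ) + 1))) := by
    intro k l hkl x hx u
    have := hx u
    have h2 : 1 / ((l : ℝ) + 1) ≤ 1 / ((k : ℝ) + 1) := by gcongr
    simp only [ContinuousMap.add_apply, ContinuousMap.const_apply] at *
    linarith
  rw [e, hanti.measure_iInter (fun k => (wulff_closed _).measurableSet.nullMeasurableSet)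
    ⟨0, measure_ne_top _ _⟩]
  refine le_iInf fun k => ?_
  obtain ⟨g, hg, hfg⟩ := Metric.mem_closure_iff.1 hf (1 / ((k : ℝ) + 1)) (by positivity)
  refine le_trans hg (measure_mono ?_)
  intro x hx u
  have h1 := hx u
  have h2 := (ContinuousMap.dist_lt_iff (by positivity)).1 hfg u
  rw [Real.dist_eq, abs_lt] at h2
  simp only [ContinuousMap.add_apply, ContinuousMap.const_apply]
  linarith

/-- The orthogonal group. -/
noncomputable abbrev OG (n : ℕ) :=
  unitary (EuclideanSpace ℝ (Fin n) →L[ℝ] EuclideanSpace ℝ (Fin n))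

instance clmStar (n : ℕ) :
    ContinuousStar (EuclideanSpace ℝ (Fin n) →L[ℝ] EuclideanSpace ℝ (Fin n)) :=
  ⟨(ContinuousLinearMap.adjoint (𝕜 := ℝ) (E := EuclideanSpace ℝ (Fin n))
    (F := EuclideanSpace ℝ (Fin n))).continuous⟩

noncomputable instance ogMeas (n : ℕ) : MeasurableSpace (OG n) := borel _
instance ogBorel (n : ℕ) : BorelSpace (OG n) := ⟨rfl⟩

instance ogCompact (n : ℕ) : CompactSpace (OG n) := by
  have : ProperSpace (EuclideanSpace ℝ (Fin n) →L[ℝ] EuclideanSpace ℝ (Fin n)) :=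
    FiniteDimensional.proper ℝ _
  apply isCompact_iff_compactSpace.1
  refine Metric.isCompact_of_isClosed_isBounded ?_ ?_
  · exact isClosed_unitary
  · refine isBounded_iff_forall_norm_le.2 ⟨1, fun x hx => ?_⟩
    refine ContinuousLinearMap.opNorm_le_bound _ zero_le_one fun v => ?_
    rw [one_mul]
    exact (Unitary.norm_map ⟨x, hx⟩ v).le

instance ogSC (n : ℕ) : SecondCountableTopology (OG n) := by
  have : ProperSpace (EuclideanSpace ℝ (Fin n) →L[ℝ] EuclideanSpace ℝ (Fin n)) :=
    FiniteDimensional.proper ℝ _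
  infer_instance

/-- Haar probability on the orthogonal group. -/
noncomputable abbrev ogHaar (n : ℕ) : Measure (OG n) :=
  Measure.haarMeasure (⊤ : TopologicalSpace.PositiveCompacts (OG n))

instance ogProb (n : ℕ) : IsProbabilityMeasure (ogHaar n) := by
  constructor
  have := Measure.haarMeasure_self (K₀ := (⊤ : TopologicalSpace.PositiveCompacts (OG n)))
  simpa using this

/-- the averaged support function -/
noncomputable def avg {n : ℕ} (K : Set (EuclideanSpace ℝ (Fin n)))
    (g : EuclideanSpace ℝ (Fin n)) : ℝ := ∫ ρ : OG n, supp K ((ρ⁻¹).1 g) ∂(ogHaar n)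

lemma act_cont {n : ℕ} {K : Set (EuclideanSpace ℝ (Fin n))} (hK : IsCompact K) :
    Continuous fun p : OG n × EuclideanSpace ℝ (Fin n) => supp K ((p.1⁻¹).1 p.2) := by
  refine (supp_cont hK).comp ?_
  have h1 : Continuous fun p : OG n × EuclideanSpace ℝ (Fin n) => (p.1⁻¹).1 :=
    continuous_subtype_val.comp (continuous_inv.comp continuous_fst)
  exact h1.clm_apply continuous_snd

lemma avg_smul {n : ℕ} (K : Set (EuclideanSpace ℝ (Fin n)))
    {c : ℝ} (hc : 0 ≤ c) (g : EuclideanSpace ℝ (Fin n)) : avg K (c • g) = c * avg K g := by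
  simp only [avg, map_smul, supp_smul K hc, integral_const_mul]

lemma avg_rot {n : ℕ} (K : Set (EuclideanSpace ℝ (Fin n))) (σ : OG n)
    (g : EuclideanSpace ℝ (Fin n)) : avg K (σ.1 g) = avg K g := by
  unfold avg
  rw [← integral_mul_left_eq_self (fun ρ : OG n => supp K ((ρ⁻¹).1 (σ.1 g))) σ]
  congr 1
  ext ρ
  congr 1
  have : (σ * ρ)⁻¹ * σ = ρ⁻¹ := by group
  rw [← this]
  rfl

lemma avg_const {n : ℕ} (K : Set (EuclideanSpace ℝ (Fin n))) {g g' : EuclideanSpace ℝ (Fin n)}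
    (h : ‖g‖ = ‖g'‖) : avg K g = avg K g' := by
  let σ : OG n := Unitary.linearIsometryEquiv.symm
    (Submodule.reflection (Submodule.span ℝ {g - g'})ᗮ)
  have : σ.1 g = g' := Submodule.reflection_sub h
  rw [← this, avg_rot]

lemma avg_form {n : ℕ} (K : Set (EuclideanSpace ℝ (Fin n)))
    (u : EuclideanSpace ℝ (Fin n)) (hu : ‖u‖ = 1) (g : EuclideanSpace ℝ (Fin n)) :
    avg K g = avg K u * ‖g‖ := by
  rw [mul_comm, ← avg_smul K (norm_nonneg g)]
  apply avg_const
  simp [norm_smul, hu]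

lemma avg_integral {n : ℕ} {K : Set (EuclideanSpace ℝ (Fin n))} (hK : IsCompact K)
    (hKn : K.Nonempty) : ∫ g, avg K g ∂(gauss n) = meanWidth n K := by
  obtain ⟨R, hR0, hR⟩ := supp_abs_le hK hKn
  have hint : Integrable (fun p : OG n × EuclideanSpace ℝ (Fin n) => supp K ((p.1⁻¹).1 p.2))
      ((ogHaar n).prod (gauss n)) := by
    have h1 : Integrable (fun p : OG n × EuclideanSpace ℝ (Fin n) => R * ‖p.2‖)
      ((ogHaar n).prod (gauss n)) := ((norm_integrable_gauss n).const_mul R).comp_snd _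
    refine h1.mono' (act_cont hK).aestronglyMeasurable (.of_forall fun p => ?_)
    refine (hR _).trans (le_of_eq ?_)
    rw [Unitary.norm_map]
  unfold avg
  have hswap := integral_integral_swap
    (f := fun (ρ : OG n) (g : EuclideanSpace ℝ (Fin n)) => supp K ((ρ⁻¹).1 g)) hint
  refine hswap.symm.trans ?_
  have : ∀ ρ : OG n, ∫ g, supp K ((ρ⁻¹).1 g) ∂(gauss n) = meanWidth n K := by
    intro ρ
    let e := Unitary.linearIsometryEquiv ρ⁻¹
    exact (gauss_map n e).integral_comp e.toHomeomorph.measurableEmbedding (supp K)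
  simp [this]

/-- rotated support function on the sphere -/
noncomputable def rotSupp {n : ℕ} {K : Set (EuclideanSpace ℝ (Fin n))} (hK : IsCompact K)
    (ρ : OG n) : C(Metric.sphere (0 : EuclideanSpace ℝ (Fin n)) 1, ℝ) where
  toFun u := supp K ((ρ⁻¹).1 u)
  continuous_toFun := (supp_cont hK).comp ((ρ⁻¹).1.continuous.comp continuous_subtype_val)

lemma rotSupp_cont {n : ℕ} {K : Set (EuclideanSpace ℝ (Fin n))} (hK : IsCompact K) :
    Continuous (rotSupp hK) := by
  apply ContinuousMap.continuous_of_continuous_uncurry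
  refine (supp_cont hK).comp ?_
  have h1 : Continuous fun p : OG n × Metric.sphere (0 : EuclideanSpace ℝ (Fin n)) 1 =>
      (p.1⁻¹).1 :=
    continuous_subtype_val.comp (continuous_inv.comp continuous_fst)
  exact h1.clm_apply (continuous_subtype_val.comp continuous_snd)

lemma rotSupp_mem {n : ℕ} {K : Set (EuclideanSpace ℝ (Fin n))} (hK : IsCompact K) (ρ : OG n) :
    gauss n K ≤ gauss n (wulff (rotSupp hK ρ)) := by
  let e := Unitary.linearIsometryEquiv ρ⁻¹
  rw [← (gauss_map n e).measure_preimage hK.measurableSet.nullMeasurableSet]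
  apply measure_mono
  intro x hx u
  have h1 := le_supp hK ((ρ⁻¹).1 u) hx
  have h2 : ⟪(ρ⁻¹).1 (u : EuclideanSpace ℝ (Fin n)), e x⟫ = ⟪(u : EuclideanSpace ℝ (Fin n)), x⟫ :=
    Unitary.inner_map_map ρ⁻¹ _ _
  rw [h2] at h1
  exact h1

lemma avg_mem {n : ℕ} {K : Set (EuclideanSpace ℝ (Fin n))} (hK : IsCompact K) :
    gauss n K ≤ gauss n {x | ∀ u : EuclideanSpace ℝ (Fin n), ‖u‖ = 1 → ⟪u, x⟫ ≤ avg K u} := by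
  have hint : Integrable (rotSupp hK) (ogHaar n) :=
    (rotSupp_cont hK).integrable_of_hasCompactSupport (HasCompactSupport.of_compactSpace _)
  have := (wulff_convex n (gauss n K)).integral_mem (wulff_isClosed n (gauss n K))
    (.of_forall (rotSupp_mem hK)) hint
  refine le_trans this (measure_mono ?_)
  intro x hx u hu
  refine (hx ⟨u, by simpa using hu⟩).trans (le_of_eq ?_)
  have h2 := (ContinuousMap.evalCLM ℝ
    (⟨u, by simpa using hu⟩ : Metric.sphere (0 : EuclideanSpace ℝ (Fin n)) 1)).integral_comp_comm
      hint
  exact h2.symm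

lemma avg_nonneg {n : ℕ} {K : Set (EuclideanSpace ℝ (Fin n))} (hK : IsCompact K)
    (hKn : K.Nonempty) (u : EuclideanSpace ℝ (Fin n)) : 0 ≤ avg K u := by
  have h1 : avg K (-u) = avg K u := avg_const K (norm_neg u)
  have hint : ∀ u, Integrable (fun ρ : OG n => supp K ((ρ⁻¹).1 u)) (ogHaar n) := by
    intro u
    have hc : Continuous (fun ρ : OG n => supp K ((ρ⁻¹).1 u)) :=
      by
      refine (supp_cont hK).comp ?_
      have h1 : Continuous fun ρ : OG n => (ρ⁻¹).1 := continuous_subtype_val.comp continuous_inv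
      exact h1.clm_apply continuous_const
    exact hc.integrable_of_hasCompactSupport (HasCompactSupport.of_compactSpace _)
  obtain ⟨x, hx⟩ := hKn
  have h3 : ∀ ρ : OG n, -supp K ((ρ⁻¹).1 u) ≤ supp K ((ρ⁻¹).1 (-u)) := by
    intro ρ
    have a1 := le_supp hK ((ρ⁻¹).1 u) hx
    have a2 := le_supp hK ((ρ⁻¹).1 (-u)) hx
    have a3 : ⟪(ρ⁻¹).1 (-u), x⟫ = -⟪(ρ⁻¹).1 u, x⟫ := by
      rw [map_neg, inner_neg_left]
    linarith
  have h2 : -avg K u ≤ avg K (-u) := by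
    unfold avg
    rw [← integral_neg]
    exact integral_mono (hint u).neg (hint (-u)) h3
  linarith

lemma urysohn_zero (K : Set (EuclideanSpace ℝ (Fin 0))) (r : ℝ)
    (hKc : IsCompact K) (hKn : K.Nonempty) :
    ∫ g, r * ‖g‖ ∂(gauss 0) ≤ ∫ g, avg K g ∂(gauss 0) := by
  have h1 : ∀ g : EuclideanSpace ℝ (Fin 0), r * ‖g‖ = 0 := fun g => by
    have : g = 0 := Subsingleton.elim g 0
    rw [this, norm_zero, mul_zero]
  simp only [h1, integral_zero]
  exact integral_nonneg fun g => avg_nonneg hKc hKn g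

lemma radius_le {n : ℕ} (hn : n ≠ 0) {K : Set (EuclideanSpace ℝ (Fin n))} {r c : ℝ}
    (hKc : IsCompact K) (h : gauss n K = gauss n (Metric.closedBall 0 r)) (hc0 : 0 ≤ c)
    (hform : ∀ g, avg K g = c * ‖g‖) : r ≤ c := by
  by_contra hlt
  have h1 := gauss_closedBall_lt hn hc0 (not_le.1 hlt)
  rw [← h] at h1
  refine absurd ((avg_mem hKc).trans (measure_mono ?_)) (not_le.2 h1)
  intro x hx
  rw [mem_closedBall_zero_iff]
  rcases eq_or_ne x 0 with hx0 | hx0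
  · rw [hx0, norm_zero]; exact hc0
  · have hx1 : ‖x‖ ≠ 0 := norm_ne_zero_iff.2 hx0
    have hx2 : ‖(‖x‖⁻¹ : ℝ) • x‖ = 1 := by
      rw [norm_smul, norm_inv, norm_norm, inv_mul_cancel₀ hx1]
    have h3 := hx _ hx2
    rw [hform, hx2, mul_one, real_inner_smul_left, real_inner_self_eq_norm_sq, sq, ← mul_assoc,
      inv_mul_cancel₀ hx1, one_mul] at h3
    exact h3

theorem stmt5 (n : ℕ) (K : Set (EuclideanSpace ℝ (Fin n))) (r : ℝ) (hr : 0 ≤ r)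
    (hK : Convex ℝ K) (hKc : IsCompact K) (hKn : K.Nonempty)
    (h : gauss n K = gauss n (Metric.closedBall 0 r)) :
    meanWidth n (Metric.closedBall 0 r) ≤ meanWidth n K := by
  rw [← avg_integral hKc hKn, meanWidth_eq]
  simp only [supp_ball hr]
  rcases eq_or_ne n 0 with hn | hn
  · subst hn
    exact urysohn_zero K r hKc hKn
  have : Nonempty (Fin n) := ⟨⟨0, Nat.pos_of_ne_zero hn⟩⟩
  have : Nontrivial (EuclideanSpace ℝ (Fin n)) := inferInstance
  obtain ⟨u, hu⟩ := exists_norm_eq (EuclideanSpace ℝ (Fin n)) zero_le_one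
  have hform := avg_form K u hu
  have hc0 : 0 ≤ avg K u := avg_nonneg hKc hKn u
  have hrc : r ≤ avg K u := radius_le hn hKc h hc0 hform
  have e : ∫ g, avg K g ∂(gauss n) = avg K u * ∫ g, ‖g‖ ∂(gauss n) := by
    rw [← integral_const_mul]
    exact integral_congr_ae (.of_forall hform)
  rw [e, integral_const_mul]
  exact mul_le_mul_of_nonneg_right hrc (integral_nonneg fun g => norm_nonneg g)
end

section
/- Šidák's lemma: for a symmetric convex body K ⊂ ℝⁿ and a strip S = {x : |⟨v, x⟩| ≤ b}, one has γ_n(K ∩ S) ≥ γ_n(K) · γ_n(S). -/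
open MeasureTheory Real
open scoped RealInnerProductSpace Pointwise
lemma sid_vol_affine (c a : ℝ) (ha : 0 < a) (K : Set ℝ) :
    volume ((fun x => c + a * x) '' K) = ENNReal.ofReal a * volume K := by
  have : (fun x => c + a * x) '' K = (fun x => c + x) '' (a • K) := by
    rw [← Set.image_smul, Set.image_image]; rfl
  rw [this, Set.image_add_left, measure_preimage_add, Measure.addHaar_smul]
  simp [abs_of_pos ha]

lemma sid_bm_compact (a b : ℝ) (ha : 0 < a) (hb : 0 < b) (K L C : Set ℝ) (hK : IsCompact K)
    (hL : IsCompact L) (nK : K.Nonempty) (nL : L.Nonempty)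
    (h : ∀ x ∈ K, ∀ y ∈ L, a * x + b * y ∈ C) :
    ENNReal.ofReal a * volume K + ENNReal.ofReal b * volume L ≤ volume C := by
  obtain ⟨p, hp⟩ := hK.exists_isGreatest nK
  obtain ⟨q, hq⟩ := hL.exists_isLeast nL
  rw [← sid_vol_affine (b * q) a ha, ← sid_vol_affine (a * p) b hb, ← measure_union₀]
  · apply measure_mono
    rintro _ (⟨x, hx, rfl⟩ | ⟨y, hy, rfl⟩)
    · have := h x hx q hq.1
      simpa [add_comm] using this
    · exact h p hp.1 y hy
  · exact (hL.image (by fun_prop)).measurableSet.nullMeasurableSet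
  · have hs : ((fun x => b * q + a * x) '' K) ∩ ((fun x => a * p + b * x) '' L) ⊆ {a * p + b * q} := by
      rintro z ⟨⟨x, hx, rfl⟩, ⟨y, hy, hxy⟩⟩
      have h1 : x ≤ p := hp.2 hx
      have h2 : q ≤ y := hq.2 hy
      simp only [Set.mem_singleton_iff] at *
      nlinarith
    exact measure_mono_null hs (by simp)

lemma sid_bm (a b : ℝ) (ha : 0 < a) (hb : 0 < b) (A B C : Set ℝ) (hA : MeasurableSet A)
    (hB : MeasurableSet B) (nA : A.Nonempty) (nB : B.Nonempty)
    (h : ∀ x ∈ A, ∀ y ∈ B, a * x + b * y ∈ C) :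
    ENNReal.ofReal a * volume A + ENNReal.ofReal b * volume B ≤ volume C := by
  by_cases hC : volume C = ⊤
  · simp [hC]
  obtain ⟨x₀, hx₀⟩ := nA
  obtain ⟨y₀, hy₀⟩ := nB
  have oa : ENNReal.ofReal a ≠ 0 := by simpa using ha
  have ob : ENNReal.ofReal b ≠ 0 := by simpa using hb
  have key : ∀ L ⊆ B, IsCompact L →
      ENNReal.ofReal a * volume A + ENNReal.ofReal b * volume L ≤ volume C := by
    intro L hLB hL
    have : volume A ≤ (volume C - ENNReal.ofReal b * volume L) / ENNReal.ofReal a := by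
      rw [hA.measure_eq_iSup_isCompact]
      refine iSup₂_le fun K hKA => iSup_le fun hK => ?_
      rw [ENNReal.le_div_iff_mul_le (Or.inl oa) (Or.inl (by simp))]
      apply ENNReal.le_sub_of_add_le_right (ENNReal.mul_ne_top (by simp) hL.measure_lt_top.ne)
      rw [mul_comm]
      refine le_trans ?_ (sid_bm_compact a b ha hb (insert x₀ K) (insert y₀ L) C (hK.insert _)
        (hL.insert _) (Set.insert_nonempty _ _) (Set.insert_nonempty _ _) ?_)
      · gcongr <;> exact Set.subset_insert _ _
      · intro x hx y hy
        exact h x (Set.insert_subset hx₀ hKA hx) y (Set.insert_subset hy₀ hLB hy)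
    rw [ENNReal.le_div_iff_mul_le (Or.inl oa) (Or.inl (by simp)), mul_comm] at this
    have h2 : ENNReal.ofReal b * volume L ≤ volume C := by
      refine le_trans ?_ (sid_bm_compact a b ha hb {x₀} (insert y₀ L) C isCompact_singleton
        (hL.insert _) (Set.singleton_nonempty _) (Set.insert_nonempty _ _) ?_)
      · simp only [Real.volume_singleton, mul_zero, zero_add]
        gcongr; exact Set.subset_insert _ _
      · intro x hx y hy
        rw [Set.mem_singleton_iff.1 hx]
        exact h x₀ hx₀ y (Set.insert_subset hy₀ hLB hy)
    calc _ ≤ (volume C - ENNReal.ofReal b * volume L) + ENNReal.ofReal b * volume L := by gcongr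
      _ = _ := tsub_add_cancel_of_le h2
  have fA : ENNReal.ofReal a * volume A ≤ volume C := by
    have := key ∅ (by simp) isCompact_empty
    simpa using this
  have : volume B ≤ (volume C - ENNReal.ofReal a * volume A) / ENNReal.ofReal b := by
    rw [hB.measure_eq_iSup_isCompact]
    refine iSup₂_le fun K hKA => iSup_le fun hK => ?_
    rw [ENNReal.le_div_iff_mul_le (Or.inl ob) (Or.inl (by simp))]
    apply ENNReal.le_sub_of_add_le_left (ne_top_of_le_ne_top hC fA)
    rw [mul_comm (volume K)]
    exact key K hKA hK
  rw [ENNReal.le_div_iff_mul_le (Or.inl ob) (Or.inl (by simp)), mul_comm] at this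
  calc _ ≤ ENNReal.ofReal a * volume A + (volume C - ENNReal.ofReal a * volume A) := by gcongr
      _ = _ := add_tsub_cancel_of_le fA

lemma sid_amgm (a b : ℝ) (ha : 0 < a) (hb : 0 < b) (hab : a + b = 1) (x y : ENNReal) :
    x ^ a * y ^ b ≤ ENNReal.ofReal a * x + ENNReal.ofReal b * y := by
  have oa : ENNReal.ofReal a ≠ 0 := by simpa using ha
  have ob : ENNReal.ofReal b ≠ 0 := by simpa using hb
  by_cases hx : x = ⊤
  · simp [hx, ENNReal.mul_top oa]
  by_cases hy : y = ⊤
  · simp [hy, ENNReal.mul_top ob]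
  lift x to NNReal using hx
  lift y to NNReal using hy
  lift a to NNReal using ha.le
  lift b to NNReal using hb.le
  have := NNReal.geom_mean_le_arith_mean2_weighted a b x y (by exact_mod_cast hab)
  rw [ENNReal.ofReal_coe_nnreal, ENNReal.ofReal_coe_nnreal, ← ENNReal.coe_rpow_of_nonneg _ ha.le,
    ← ENNReal.coe_rpow_of_nonneg _ hb.le]
  exact_mod_cast this

lemma sid_layer (f : ℝ → ENNReal) (hf : Measurable f) (h1 : ∀ x, f x ≤ 1) :
    ∫⁻ x, f x = ∫⁻ t in Set.Ioi (0 : ℝ), volume {x | ENNReal.ofReal t < f x} := by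
  have := lintegral_eq_lintegral_meas_lt (volume : Measure ℝ) (f := fun x => (f x).toReal)
    (Filter.Eventually.of_forall fun x => ENNReal.toReal_nonneg) hf.ennreal_toReal.aemeasurable
  have ht : ∀ x, f x ≠ ⊤ := fun x => ne_top_of_le_ne_top (by simp) (h1 x)
  simp only [ENNReal.ofReal_toReal (ht _)] at this
  rw [this]
  refine setLIntegral_congr_fun measurableSet_Ioi fun t ht' => ?_
  simp only [ENNReal.ofReal_lt_iff_lt_toReal (le_of_lt ht') (ht _)]

lemma sid_pl_norm (a b : ℝ) (ha : 0 < a) (hb : 0 < b) (hab : a + b = 1) (f g h : ℝ → ENNReal)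
    (hf : Measurable f) (hg : Measurable g) (hh : Measurable h)
    (sf : ⨆ x, f x = 1) (sg : ⨆ x, g x = 1)
    (H : ∀ x y, f x ^ a * g y ^ b ≤ h (a * x + b * y)) :
    (∫⁻ x, f x) ^ a * (∫⁻ x, g x) ^ b ≤ ∫⁻ x, h x := by
  have f1 : ∀ x, f x ≤ 1 := fun x => sf ▸ le_iSup f x
  have g1 : ∀ x, g x ≤ 1 := fun x => sg ▸ le_iSup g x
  refine (sid_amgm a b ha hb hab _ _).trans ?_
  have hm : Measurable fun x => min (h x) 1 := hh.min measurable_const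
  refine le_trans ?_ (lintegral_mono (fun x => min_le_left (h x) 1))
  rw [sid_layer f hf f1, sid_layer g hg g1, sid_layer _ hm (fun x => min_le_right _ _)]
  have anti : ∀ f : ℝ → ENNReal, Measurable fun t : ℝ => volume {x | ENNReal.ofReal t < f x} := by
    intro f
    apply Antitone.measurable
    intro s t hst
    refine measure_mono fun x hx => lt_of_le_of_lt (ENNReal.ofReal_le_ofReal hst) hx
  rw [← lintegral_const_mul _ (anti f), ← lintegral_const_mul _ (anti g),
    ← lintegral_add_left ((anti f).const_mul _)]
  refine setLIntegral_mono' measurableSet_Ioi fun t ht => ?_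
  by_cases h1 : t < 1
  · have h1' : ENNReal.ofReal t < 1 := by simpa using h1
    apply sid_bm a b ha hb
    · exact measurableSet_lt measurable_const hf
    · exact measurableSet_lt measurable_const hg
    · exact lt_iSup_iff.1 (sf ▸ h1')
    · exact lt_iSup_iff.1 (sg ▸ h1')
    · intro x hx y hy
      refine lt_min (lt_of_lt_of_le ?_ (H x y)) h1'
      have : ENNReal.ofReal t = ENNReal.ofReal t ^ a * ENNReal.ofReal t ^ b := by
        rw [← ENNReal.rpow_add_of_nonneg _ _ ha.le hb.le, hab, ENNReal.rpow_one]
      rw [this]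
      exact ENNReal.mul_lt_mul (ENNReal.rpow_lt_rpow hx ha) (ENNReal.rpow_lt_rpow hy hb)
  · have e : ∀ f : ℝ → ENNReal, (∀ x, f x ≤ 1) → {x | ENNReal.ofReal t < f x} = ∅ := by
      intro f hf
      ext x
      simp only [Set.mem_ofPred_eq, Set.mem_empty_iff_false, iff_false, not_lt]
      exact (hf x).trans (by simpa using not_lt.1 h1)
    simp [e f f1, e g g1]

lemma sid_pl (a b : ℝ) (ha : 0 < a) (hb : 0 < b) (hab : a + b = 1) (f g h : ℝ → ENNReal)
    (hf : Measurable f) (hg : Measurable g) (hh : Measurable h)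
    (sf : ⨆ x, f x ≠ ⊤) (sg : ⨆ x, g x ≠ ⊤)
    (H : ∀ x y, f x ^ a * g y ^ b ≤ h (a * x + b * y)) :
    (∫⁻ x, f x) ^ a * (∫⁻ x, g x) ^ b ≤ ∫⁻ x, h x := by
  set F := ⨆ x, f x with hF
  set G := ⨆ x, g x with hG
  by_cases F0 : F = 0
  · have : ∀ x, f x = 0 := by simpa [F0] using hF.symm
    simp [this, ha]
  by_cases G0 : G = 0
  · have : ∀ x, g x = 0 := by simpa [G0] using hG.symm
    simp [this, hb]
  have c0 : F ^ a * G ^ b ≠ 0 := by simp [F0, G0, sf, sg, ha.le, hb.le]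
  have ct : F ^ a * G ^ b ≠ ⊤ := ENNReal.mul_ne_top (by simp [sf, ha.le]) (by simp [sg, hb.le])
  have ci : (F ^ a * G ^ b)⁻¹ = F⁻¹ ^ a * G⁻¹ ^ b := by
    rw [ENNReal.inv_rpow, ENNReal.inv_rpow, ENNReal.mul_inv]
    · left; simp [F0, sf, ha.le]
    · left; simp [sf, ha.le]
  have := sid_pl_norm a b ha hb hab (fun x => F⁻¹ * f x) (fun x => G⁻¹ * g x)
    (fun x => (F ^ a * G ^ b)⁻¹ * h x) (hf.const_mul _) (hg.const_mul _) (hh.const_mul _)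
    (by rw [← ENNReal.mul_iSup, ← hF, ENNReal.inv_mul_cancel F0 sf])
    (by rw [← ENNReal.mul_iSup, ← hG, ENNReal.inv_mul_cancel G0 sg])
    (by
      intro x y
      rw [ENNReal.mul_rpow_of_nonneg _ _ ha.le, ENNReal.mul_rpow_of_nonneg _ _ hb.le, ci,
        mul_mul_mul_comm]
      gcongr
      exact H x y)
  rw [lintegral_const_mul _ hf, lintegral_const_mul _ hg, lintegral_const_mul _ hh,
    ENNReal.mul_rpow_of_nonneg _ _ ha.le, ENNReal.mul_rpow_of_nonneg _ _ hb.le,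
        mul_mul_mul_comm, ← ci] at this
  exact (ENNReal.mul_le_mul_iff_right (ENNReal.inv_ne_zero.2 ct) (ENNReal.inv_ne_top.2 c0)).1 this

/-- The standard Gaussian on the line. -/
noncomputable abbrev sidG : Measure ℝ := ProbabilityTheory.gaussianReal 0 1

lemma sid_lintegral_G (f : ℝ → ENNReal) (hf : Measurable f) :
    ∫⁻ x, f x ∂sidG = ∫⁻ x, ProbabilityTheory.gaussianPDF 0 1 x * f x := by
  rw [sidG, ProbabilityTheory.gaussianReal_of_var_ne_zero _ one_ne_zero,
    lintegral_withDensity_eq_lintegral_mul _ (ProbabilityTheory.measurable_gaussianPDF _ _) hf]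
  rfl

lemma sid_pdf_le (x : ℝ) : ProbabilityTheory.gaussianPDF 0 1 x ≤ ENNReal.ofReal ((√(2 * π))⁻¹) := by
  rw [ProbabilityTheory.gaussianPDF]
  apply ENNReal.ofReal_le_ofReal
  rw [ProbabilityTheory.gaussianPDFReal]
  simp only [NNReal.coe_one, mul_one, sub_zero]
  apply mul_le_of_le_one_right (by positivity)
  rw [Real.exp_le_one_iff]
  have := sq_nonneg x
  linarith

lemma sid_pdf_log (a b : ℝ) (ha : 0 < a) (hb : 0 < b) (hab : a + b = 1) (x y : ℝ) :
    ProbabilityTheory.gaussianPDF 0 1 x ^ a * ProbabilityTheory.gaussianPDF 0 1 y ^ b ≤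
      ProbabilityTheory.gaussianPDF 0 1 (a * x + b * y) := by
  simp only [ProbabilityTheory.gaussianPDF]
  have p := fun x => ProbabilityTheory.gaussianPDFReal_pos 0 1 x one_ne_zero
  rw [ENNReal.ofReal_rpow_of_pos (p x), ENNReal.ofReal_rpow_of_pos (p y),
    ← ENNReal.ofReal_mul (Real.rpow_nonneg (p x).le _)]
  apply ENNReal.ofReal_le_ofReal
  simp only [ProbabilityTheory.gaussianPDFReal, NNReal.coe_one, mul_one, sub_zero]
  have c : 0 < (√(2 * π))⁻¹ := by positivity
  rw [Real.mul_rpow c.le (Real.exp_pos _).le, Real.mul_rpow c.le (Real.exp_pos _).le,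
    mul_mul_mul_comm, ← Real.rpow_add c, hab, Real.rpow_one, ← Real.exp_mul, ← Real.exp_mul,
    ← Real.exp_add]
  gcongr
  obtain rfl : b = 1 - a := by linarith
  nlinarith [mul_nonneg (mul_nonneg ha.le hb.le) (sq_nonneg (x - y))]

lemma sid_plG (a b : ℝ) (ha : 0 < a) (hb : 0 < b) (hab : a + b = 1) (f g h : ℝ → ENNReal)
    (hf : Measurable f) (hg : Measurable g) (hh : Measurable h)
    (sf : ∀ x, f x ≤ 1) (sg : ∀ x, g x ≤ 1)
    (H : ∀ x y, f x ^ a * g y ^ b ≤ h (a * x + b * y)) :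
    (∫⁻ x, f x ∂sidG) ^ a * (∫⁻ x, g x ∂sidG) ^ b ≤ ∫⁻ x, h x ∂sidG := by
  rw [sid_lintegral_G f hf, sid_lintegral_G g hg, sid_lintegral_G h hh]
  have pm := ProbabilityTheory.measurable_gaussianPDF 0 1
  have bd : ∀ f : ℝ → ENNReal, (∀ x, f x ≤ 1) →
      ⨆ x, ProbabilityTheory.gaussianPDF 0 1 x * f x ≠ ⊤ := by
    intro f hf
    refine ne_top_of_le_ne_top (b := ENNReal.ofReal ((√(2 * π))⁻¹) * 1)
      (ENNReal.mul_ne_top ENNReal.ofReal_ne_top ENNReal.one_ne_top) (iSup_le fun x => ?_)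
    exact mul_le_mul' (sid_pdf_le x) (hf x)
  refine sid_pl a b ha hb hab _ _ _ (pm.mul hf) (pm.mul hg) (pm.mul hh) (bd f sf) (bd g sg) ?_
  intro x y
  rw [ENNReal.mul_rpow_of_nonneg _ _ ha.le, ENNReal.mul_rpow_of_nonneg _ _ hb.le, mul_mul_mul_comm]
  exact mul_le_mul' (sid_pdf_log a b ha hb hab x y) (H x y)

/-- The standard Gaussian on `Fin n → ℝ`. -/
noncomputable abbrev sidP (n : ℕ) : Measure (Fin n → ℝ) := Measure.pi fun _ => sidG

lemma sid_measurable_cons (m : ℕ) :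
    Measurable (fun p : ℝ × (Fin m → ℝ) => (Fin.cons p.1 p.2 : Fin (m + 1) → ℝ)) := by
  rw [measurable_pi_iff]
  intro i
  refine Fin.cases ?_ (fun j => ?_) i
  · simpa using measurable_fst
  · simp only [Fin.cons_succ]; fun_prop

lemma sid_fubini (μ : Measure ℝ) [SigmaFinite μ] (m : ℕ) (f : (Fin (m + 1) → ℝ) → ENNReal)
    (hf : Measurable f) :
    ∫⁻ x, f x ∂(Measure.pi fun _ => μ) =
      ∫⁻ t, ∫⁻ y, f (Fin.cons t y) ∂(Measure.pi fun _ => μ) ∂μ := by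
  have e := (measurePreserving_piFinSuccAbove (fun _ : Fin (m + 1) => μ) 0).symm
  rw [← e.lintegral_comp hf, lintegral_prod]
  · simp [Fin.insertNthEquiv, Fin.insertNth_zero']
  · exact (hf.comp e.measurable).aemeasurable

lemma sid_plP (a b : ℝ) (ha : 0 < a) (hb : 0 < b) (hab : a + b = 1) (m : ℕ) :
    ∀ (f g h : (Fin m → ℝ) → ENNReal)
    (_ : Measurable f) (_ : Measurable g) (_ : Measurable h)
    (_ : ∀ x, f x ≤ 1) (_ : ∀ x, g x ≤ 1)
    (_ : ∀ x y, f x ^ a * g y ^ b ≤ h (a • x + b • y)),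
    (∫⁻ x, f x ∂(sidP m)) ^ a * (∫⁻ x, g x ∂(sidP m)) ^ b ≤ ∫⁻ x, h x ∂(sidP m) := by
  induction m with
  | zero =>
    intro f g h hf hg hh sf sg H
    simp only [sidP, Measure.pi_of_empty _ (0 : Fin 0 → ℝ), lintegral_dirac]
    simpa using H 0 0
  | succ m ih =>
    intro f g h hf hg hh sf sg H
    have mc : ∀ f : (Fin (m + 1) → ℝ) → ENNReal, Measurable f →
        Measurable fun t => ∫⁻ y, f (Fin.cons t y) ∂(sidP m) := fun f hf =>
      (hf.comp (sid_measurable_cons m)).lintegral_prod_right'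
    have m1 : ∀ (t : ℝ) (f : (Fin (m + 1) → ℝ) → ENNReal), Measurable f →
        Measurable fun y : Fin m → ℝ => f (Fin.cons t y) := fun t f hf =>
      (hf.comp (sid_measurable_cons m)).comp measurable_prodMk_left
    have l1 : ∀ f : (Fin (m + 1) → ℝ) → ENNReal, (∀ x, f x ≤ 1) →
        ∀ t, ∫⁻ y, f (Fin.cons t y) ∂(sidP m) ≤ 1 := by
      intro f hf t
      calc _ ≤ ∫⁻ y, 1 ∂(sidP m) := lintegral_mono fun y => hf _
        _ = 1 := by simp
    rw [sidP, sid_fubini _ _ f hf, sid_fubini _ _ g hg, sid_fubini _ _ h hh]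
    refine sid_plG a b ha hb hab _ _ _ (mc f hf) (mc g hg) (mc h hh) (l1 f sf) (l1 g sg) ?_
    intro s t
    refine ih _ _ _ (m1 s f hf) (m1 t g hg) (m1 _ h hh) (fun _ => sf _) (fun _ => sg _) ?_
    intro x y
    refine (H _ _).trans_eq ?_
    congr 1
    ext i
    refine Fin.cases ?_ (fun j => ?_) i <;> simp

lemma sid_neg (m : ℕ) : MeasurePreserving (fun x : Fin m → ℝ => -x) (sidP m) (sidP m) := by
  refine measurePreserving_pi (f := fun _ x => -x) _ _ fun i => ⟨by fun_prop, ?_⟩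
  simp [ProbabilityTheory.gaussianReal_map_neg]

/-- The measure of sections is monotone. -/
lemma sid_section (m : ℕ) (K : Set (Fin (m + 1) → ℝ)) (hK : Convex ℝ K) (hm : MeasurableSet K)
    (hs : ∀ x ∈ K, -x ∈ K) (s t : ℝ) (hst : |t| ≤ |s|) :
    sidP m {y | Fin.cons s y ∈ K} ≤ sidP m {y | Fin.cons t y ∈ K} := by
  have ms : ∀ t : ℝ, MeasurableSet {y : Fin m → ℝ | (Fin.cons t y : Fin (m + 1) → ℝ) ∈ K} :=
    fun t => hm.preimage ((sid_measurable_cons m).comp measurable_prodMk_left)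
  have even : ∀ s : ℝ, sidP m {y | Fin.cons (-s) y ∈ K} = sidP m {y | Fin.cons s y ∈ K} := by
    intro s
    rw [← (sid_neg m).measure_preimage (ms (-s)).nullMeasurableSet]
    congr 1
    ext y
    have hc : (Fin.cons (-s) (-y) : Fin (m + 1) → ℝ) = -Fin.cons s y := by
      ext i
      refine Fin.cases ?_ (fun j => ?_) i <;> simp
    show Fin.cons (-s) (-y) ∈ K ↔ Fin.cons s y ∈ K
    rw [hc]
    exact ⟨fun h => by simpa using hs _ h, hs _⟩
  rcases hst.eq_or_lt with h | h
  · rcases abs_eq_abs.1 h with rfl | rfl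
    · rfl
    · rw [even]
  have s0 : 0 < |s| := (abs_nonneg t).trans_lt h
  have s1 : sidP m {y | Fin.cons s y ∈ K} = sidP m {y | Fin.cons |s| y ∈ K} := by
    rcases abs_choice s with h | h <;> rw [h]
    rw [even]
  rw [s1]
  generalize |s| = r at *
  obtain ⟨h1, h2⟩ := abs_lt.1 h
  have ha : 0 < (r + t) / (2 * r) := div_pos (by linarith) (by linarith)
  have hb : 0 < (r - t) / (2 * r) := div_pos (by linarith) (by linarith)
  have hab : (r + t) / (2 * r) + (r - t) / (2 * r) = 1 := by field_simp; ring
  have ht : (r + t) / (2 * r) * r + (r - t) / (2 * r) * (-r) = t := by field_simp; ring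
  generalize (r + t) / (2 * r) = a at *
  generalize (r - t) / (2 * r) = b at *
  have := sid_plP a b ha hb hab m ({y | Fin.cons r y ∈ K}.indicator 1)
    ({y | Fin.cons (-r) y ∈ K}.indicator 1) ({y | Fin.cons t y ∈ K}.indicator 1)
    (measurable_one.indicator (ms _)) (measurable_one.indicator (ms _))
    (measurable_one.indicator (ms _)) (fun x => Set.indicator_le_self' (by simp) x)
    (fun x => Set.indicator_le_self' (by simp) x) (by
      intro x y
      by_cases hx : Fin.cons r x ∈ K
      · by_cases hy : Fin.cons (-r) y ∈ K
        · have hz : Fin.cons t (a • x + b • y) ∈ K := by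
            have := hK hx hy ha.le hb.le hab
            convert this using 1
            ext i
            refine Fin.cases ?_ (fun j => ?_) i
            · simp [ht.symm]
            · simp
          simp [Set.indicator, hx, hy, hz]
        · simp [Set.indicator, hy, hb]
      · simp [Set.indicator, hx, ha])
  rw [lintegral_indicator_one (ms _), lintegral_indicator_one (ms _),
    lintegral_indicator_one (ms _), even, ← ENNReal.rpow_add_of_nonneg _ _ ha.le hb.le, hab,
    ENNReal.rpow_one] at this
  exact this

lemma sid_product (m : ℕ) (K : Set (Fin (m + 1) → ℝ)) (hK : Convex ℝ K) (hm : MeasurableSet K)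
    (hs : ∀ x ∈ K, -x ∈ K) (c : ℝ) (hc : 0 ≤ c) :
    sidP (m + 1) K * sidP (m + 1) {x | |x 0| ≤ c} ≤ sidP (m + 1) (K ∩ {x | |x 0| ≤ c}) := by
  set I : Set ℝ := {t | |t| ≤ c} with hI
  have mI : MeasurableSet I := measurableSet_le (by fun_prop) measurable_const
  have mS : MeasurableSet {x : Fin (m + 1) → ℝ | |x 0| ≤ c} :=
    measurableSet_le (by fun_prop) measurable_const
  set φ : ℝ → ENNReal := fun t => sidP m {y | Fin.cons t y ∈ K} with hφ
  have ms : ∀ t : ℝ, MeasurableSet {y : Fin m → ℝ | (Fin.cons t y : Fin (m + 1) → ℝ) ∈ K} :=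
    fun t => hm.preimage ((sid_measurable_cons m).comp measurable_prodMk_left)
  have e1 : sidP (m + 1) K = ∫⁻ t, φ t ∂sidG := by
    rw [← lintegral_indicator_one hm, sidP, sid_fubini _ _ _ (measurable_one.indicator hm)]
    refine lintegral_congr fun t => ?_
    rw [hφ]
    simp only
    rw [← lintegral_indicator_one (ms t)]
    rfl
  have e2 : sidP (m + 1) (K ∩ {x | |x 0| ≤ c}) = ∫⁻ t in I, φ t ∂sidG := by
    rw [← lintegral_indicator_one (hm.inter mS), sidP,
      sid_fubini _ _ _ (measurable_one.indicator (hm.inter mS)), ← lintegral_indicator mI]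
    refine lintegral_congr fun t => ?_
    by_cases ht : |t| ≤ c
    · rw [Set.indicator_of_mem (show t ∈ I from ht), hφ]
      simp only
      rw [← lintegral_indicator_one (ms t)]
      refine lintegral_congr fun y => ?_
      have hiff : (Fin.cons t y : Fin (m + 1) → ℝ) ∈ K ∩ {x | |x 0| ≤ c} ↔ Fin.cons t y ∈ K :=
        ⟨fun h => h.1, fun h => ⟨h, ht⟩⟩
      by_cases hy : (Fin.cons t y : Fin (m + 1) → ℝ) ∈ K
      · rw [Set.indicator_of_mem (hiff.2 hy),
          Set.indicator_of_mem (show y ∈ {y | (Fin.cons t y : Fin (m + 1) → ℝ) ∈ K} from hy)]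
        rfl
      · rw [Set.indicator_of_notMem (fun h => hy (hiff.1 h)),
          Set.indicator_of_notMem (show y ∉ {y | (Fin.cons t y : Fin (m + 1) → ℝ) ∈ K} from hy)]
    · rw [Set.indicator_of_notMem (show t ∉ I from ht)]
      simp [Set.indicator, ht]
  have e3 : sidP (m + 1) {x | |x 0| ≤ c} = sidG I := by
    have := (measurePreserving_eval (fun _ : Fin (m + 1) => sidG) 0).measure_preimage
      mI.nullMeasurableSet
    exact this
  rw [e1, e2, e3, ← lintegral_add_compl φ mI]
  have u : sidG I + sidG Iᶜ = 1 := by rw [measure_add_measure_compl mI]; simp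
  have b1 : φ c * sidG I ≤ ∫⁻ t in I, φ t ∂sidG := by
    rw [← setLIntegral_const]
    exact setLIntegral_mono' mI fun t ht =>
      sid_section m K hK hm hs c t (by rw [abs_of_nonneg hc]; exact ht)
  have b2 : ∫⁻ t in Iᶜ, φ t ∂sidG ≤ φ c * sidG Iᶜ := by
    rw [← setLIntegral_const]
    exact setLIntegral_mono' mI.compl fun t ht =>
      sid_section m K hK hm hs t c (by rw [abs_of_nonneg hc]; exact le_of_lt (not_le.1 ht))
  calc _ ≤ (∫⁻ t in I, φ t ∂sidG) * sidG I + φ c * sidG Iᶜ * sidG I := by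
        rw [add_mul]; gcongr
    _ = (∫⁻ t in I, φ t ∂sidG) * sidG I + φ c * sidG I * sidG Iᶜ := by ring
    _ ≤ (∫⁻ t in I, φ t ∂sidG) * sidG I + (∫⁻ t in I, φ t ∂sidG) * sidG Iᶜ := by gcongr
    _ = _ := by rw [← mul_add, u, mul_one]

lemma sid_prod_lintegral (n : ℕ) : ∀ (g : Fin n → ℝ → ENNReal) (_ : ∀ i, Measurable (g i)),
    ∫⁻ x : Fin n → ℝ, ∏ i, g i (x i) = ∏ i, ∫⁻ t, g i t := by
  induction n with
  | zero =>
    intro g hg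
    rw [volume_pi, Measure.pi_of_empty _ (0 : Fin 0 → ℝ), lintegral_dirac]
    simp
  | succ n ih =>
    intro g hg
    have mm : ∀ n (g : Fin n → ℝ → ENNReal) (_ : ∀ i, Measurable (g i)),
        Measurable fun x : Fin n → ℝ => ∏ i, g i (x i) := by
      intro n g hg
      exact Finset.measurable_prod _ fun i _ => (hg i).comp (measurable_pi_apply i)
    rw [volume_pi, sid_fubini _ _ _ (mm _ g hg), Fin.prod_univ_succ, ← ih _ fun i => hg i.succ,
      ← lintegral_mul_const _ (hg 0)]
    refine lintegral_congr fun t => ?_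
    rw [← volume_pi, ← lintegral_const_mul _ (mm n (fun i => g i.succ) fun i => hg i.succ)]
    simp [Fin.prod_univ_succ]

lemma sid_gauss_pi (n : ℕ) : (gauss n).map WithLp.ofLp = sidP n := by
  refine (Measure.pi_eq fun s hs => ?_).symm
  have mbox : MeasurableSet (Set.univ.pi s) := MeasurableSet.univ_pi hs
  have mo : Measurable (WithLp.ofLp : EuclideanSpace ℝ (Fin n) → Fin n → ℝ) :=
    (PiLp.volume_preserving_ofLp (Fin n)).measurable
  rw [Measure.map_apply mo mbox, gauss, withDensity_apply _ (mo mbox)]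
  have : ∀ i, sidG (s i) = ∫⁻ t, (s i).indicator (ProbabilityTheory.gaussianPDF 0 1) t := by
    intro i
    rw [lintegral_indicator (hs i), sidG,
      ProbabilityTheory.gaussianReal_apply _ one_ne_zero]
  simp_rw [this]
  rw [← sid_prod_lintegral n _ fun i =>
    (ProbabilityTheory.measurable_gaussianPDF 0 1).indicator (hs i),
    ← (PiLp.volume_preserving_ofLp (Fin n)).lintegral_comp, ← lintegral_indicator (mo mbox)]
  · refine lintegral_congr fun x => ?_
    by_cases hx : ∀ i, x i ∈ s i
    · rw [Set.indicator_of_mem (by simpa using hx)]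
      simp_rw [Set.indicator_of_mem (hx _), ProbabilityTheory.gaussianPDF]
      rw [← ENNReal.ofReal_prod_of_nonneg fun i _ => ProbabilityTheory.gaussianPDFReal_nonneg _ _ _]
      congr 1
      simp only [ProbabilityTheory.gaussianPDFReal, NNReal.coe_one, mul_one, sub_zero]
      rw [Finset.prod_mul_distrib, ← Real.exp_sum, EuclideanSpace.real_norm_sq_eq, Finset.prod_const,
        ← Finset.sum_div, Finset.sum_neg_distrib, Finset.card_univ, Fintype.card_fin,
        Real.sqrt_eq_rpow, ← Real.rpow_neg (by positivity), ← Real.rpow_mul_natCast (by positivity)]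
      congr 2
      ring
    · rw [Set.indicator_of_notMem (by simpa using hx)]
      push Not at hx
      obtain ⟨i, hi⟩ := hx
      symm
      apply Finset.prod_eq_zero (Finset.mem_univ i)
      exact Set.indicator_of_notMem hi _
  · exact Finset.measurable_prod _ fun i _ =>
      ((ProbabilityTheory.measurable_gaussianPDF 0 1).indicator (hs i)).comp (measurable_pi_apply i)

lemma sid_gauss_std (n : ℕ) :
    gauss n = ProbabilityTheory.stdGaussian (EuclideanSpace ℝ (Fin n)) := by
  rw [← ProbabilityTheory.map_pi_eq_stdGaussian]
  have := sid_gauss_pi n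
  rw [sidP, sidG] at this
  rw [← this, Measure.map_map (PiLp.volume_preserving_toLp (Fin n)).measurable
    (PiLp.volume_preserving_ofLp (Fin n)).measurable]
  exact Measure.map_id.symm

lemma sid_closed (n : ℕ) (K : Set (EuclideanSpace ℝ (Fin n)))
    (v : EuclideanSpace ℝ (Fin n)) (b : ℝ) (hb : 0 ≤ b) (hc : IsClosed K)
    (hK : Convex ℝ K) (hsym : ∀ x ∈ K, -x ∈ K) :
    gauss n K * gauss n {x | |⟪v, x⟫| ≤ b} ≤ gauss n (K ∩ {x | |⟪v, x⟫| ≤ b}) := by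
  have : IsProbabilityMeasure (gauss n) := by rw [sid_gauss_std]; infer_instance
  by_cases hv : v = 0
  · simp [hv, hb]
  rcases n with _ | m
  · exact absurd (Subsingleton.elim _ _) hv
  have nv : 0 < ‖v‖ := norm_pos_iff.2 hv
  obtain ⟨B, hB⟩ := Orthonormal.exists_orthonormalBasis_extension_of_card_eq (𝕜 := ℝ)
    (E := EuclideanSpace ℝ (Fin (m + 1))) (ι := Fin (m + 1)) (by simp)
    (v := fun _ => ‖v‖⁻¹ • v) (s := {0}) (by
      constructor
      · intro i
        simp [Set.domRestrict, norm_smul, nv.ne']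
      · intro i j hij
        exact absurd (Subsingleton.elim _ _) hij)
  have hB0 := hB 0 rfl
  set T : (Fin (m + 1) → ℝ) → EuclideanSpace ℝ (Fin (m + 1)) := fun x => ∑ i, x i • B i with hT
  have cT : Continuous T := by fun_prop
  have eT : gauss (m + 1) = (sidP (m + 1)).map T := by
    rw [sid_gauss_std, ProbabilityTheory.stdGaussian_eq_map_pi_orthonormalBasis B]
  have mS : MeasurableSet {x : EuclideanSpace ℝ (Fin (m + 1)) | |⟪v, x⟫| ≤ b} :=
    (isClosed_le (by fun_prop) (by fun_prop)).measurableSet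
  have iv : ∀ x, ⟪v, T x⟫ = ‖v‖ * x 0 := by
    intro x
    have : v = ‖v‖ • B 0 := by rw [hB0, smul_smul, mul_inv_cancel₀ nv.ne', one_smul]
    rw [hT]
    simp only
    conv_lhs => rw [this]
    rw [inner_smul_left, B.orthonormal.inner_right_fintype]
    simp
  have pS : T ⁻¹' {x | |⟪v, x⟫| ≤ b} = {x | |x 0| ≤ b / ‖v‖} := by
    ext x
    show |⟪v, T x⟫| ≤ b ↔ |x 0| ≤ b / ‖v‖
    rw [iv, abs_mul, abs_of_pos nv, le_div_iff₀ nv, mul_comm]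
  rw [eT, Measure.map_apply cT.measurable hc.measurableSet, Measure.map_apply cT.measurable mS,
    Measure.map_apply cT.measurable (hc.measurableSet.inter mS), Set.preimage_inter, pS]
  refine sid_product m _ ?_ (cT.measurable hc.measurableSet) ?_ _ (by positivity)
  · intro x hx y hy p q hp hq hpq
    have := hK hx hy hp hq hpq
    show T _ ∈ K
    convert this using 1
    simp [hT, add_smul, Finset.sum_add_distrib, Finset.smul_sum, smul_smul]
  · intro x hx
    have := hsym _ hx
    show T _ ∈ K
    convert this using 1
    simp [hT]

theorem stmt9 (n : ℕ) (K : Set (EuclideanSpace ℝ (Fin n)))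
    (v : EuclideanSpace ℝ (Fin n)) (b : ℝ) (hb : 0 ≤ b)
    (hK : Convex ℝ K) (hsym : K = -K) :
    gauss n K * gauss n {x | |⟪v, x⟫| ≤ b} ≤ gauss n (K ∩ {x | |⟪v, x⟫| ≤ b}) := by
  have ae : (closure K : Set _) =ᵐ[gauss n] K := by
    refine (withDensity_absolutelyContinuous _ _).ae_le ?_
    exact closure_ae_eq_of_null_frontier (hK.addHaar_frontier volume)
  have ae2 : (closure K ∩ {x | |⟪v, x⟫| ≤ b} : Set _) =ᵐ[gauss n]
      (K ∩ {x | |⟪v, x⟫| ≤ b} : Set _) := by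
    filter_upwards [ae] with x hx
    have hx' : (x ∈ closure K) = (x ∈ K) := hx
    show (x ∈ closure K ∧ _) = (x ∈ K ∧ _)
    rw [hx']
  rw [← measure_congr ae, ← measure_congr ae2]
  refine sid_closed n _ v b hb isClosed_closure hK.closure ?_
  intro x hx
  have : closure K = -closure K := by
    rw [neg_closure, ← hsym]
  rw [this] at hx
  exact hx
end
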